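/- For every nonnegative integer m there exists a constant C = C(m) > 0 such that for every sufficiently smooth function u on (0,1] (with the relevant norms finite): (i) ‖s u'‖_{X^m} ≤ C ‖u‖_{X^{m+1}}, where (s u')(s) = s·u'(s); (ii) ‖u'‖_{X^m} ≤ ‖u‖_{X^{m+2}}; (iii) sup_{0<s<1} |∂_s^m u(s)| ≤ C ‖u‖_{X^{2m+2}}. -/

import Mathlib

open MeasureTheory ENNReal RealInnerProductSpace

noncomputable section

/-- The weighted L² norm `‖s^α v‖_{L²(0,1)} = (∫₀¹ s^{2α} ‖v s‖² ds)^{1/2}`, valued in `[0,∞]`. -/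
def wL2 {E : Type*} [NormedAddCommGroup E] (α : ℝ) (v : ℝ → E) : ℝ≥0∞ :=
  (∫⁻ s in Set.Ioo (0:ℝ) 1, ENNReal.ofReal (s ^ (2 * α) * ‖v s‖ ^ 2)) ^ ((1:ℝ) / 2)

/-- The weighted L^∞ norm `‖s^α v‖_{L^∞(0,1)} = sup_{0<s<1} s^α ‖v s‖`, valued in `[0,∞]`. -/
def wLinf {E : Type*} [NormedAddCommGroup E] (α : ℝ) (v : ℝ → E) : ℝ≥0∞ :=
  ⨆ s : Set.Ioo (0:ℝ) 1, ENNReal.ofReal ((s : ℝ) ^ α * ‖v (s : ℝ)‖)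

/-- The square of the weighted Sobolev norm `X^m` on `(0,1)`:
for `m = 2k`, `‖u‖_{X^m}² = Σ_{i=0}^{k} ‖∂^i u‖² + Σ_{j=1}^{k} ‖s^j ∂^{k+j} u‖²`;
for `m = 2k+1`, `‖u‖_{X^m}² = Σ_{i=0}^{k} ‖∂^i u‖² + Σ_{j=1}^{k+1} ‖s^{j-1/2} ∂^{k+j} u‖²`. -/
def XnormSq {E : Type*} [NormedAddCommGroup E] [NormedSpace ℝ E] (m : ℕ) (u : ℝ → E) : ℝ≥0∞ :=
  if m % 2 = 0 then
    (∑ i ∈ Finset.range (m / 2 + 1), wL2 0 (iteratedDeriv i u) ^ 2) +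
      ∑ j ∈ Finset.range (m / 2), wL2 ((j : ℝ) + 1) (iteratedDeriv (m / 2 + j + 1) u) ^ 2
  else
    (∑ i ∈ Finset.range (m / 2 + 1), wL2 0 (iteratedDeriv i u) ^ 2) +
      ∑ j ∈ Finset.range (m / 2 + 1), wL2 ((j : ℝ) + 1 / 2) (iteratedDeriv (m / 2 + j + 1) u) ^ 2

/-- The weighted Sobolev norm `X^m`, valued in `[0,∞]`. -/
def Xnorm {E : Type*} [NormedAddCommGroup E] [NormedSpace ℝ E] (m : ℕ) (u : ℝ → E) : ℝ≥0∞ :=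
  XnormSq m u ^ ((1:ℝ) / 2)

/-- The square of the companion weighted Sobolev norm `Y^m` on `(0,1)`:
for `m = 2k`, `‖u‖_{Y^m}² = Σ_{i=0}^{k-1} ‖∂^i u‖² + Σ_{j=1}^{k+1} ‖s^{j-1/2} ∂^{k+j-1} u‖²`;
for `m = 2k+1`, `‖u‖_{Y^m}² = Σ_{i=0}^{k} ‖∂^i u‖² + Σ_{j=1}^{k+1} ‖s^{j} ∂^{k+j} u‖²`. -/
def YnormSq {E : Type*} [NormedAddCommGroup E] [NormedSpace ℝ E] (m : ℕ) (u : ℝ → E) : ℝ≥0∞ :=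
  if m % 2 = 0 then
    (∑ i ∈ Finset.range (m / 2), wL2 0 (iteratedDeriv i u) ^ 2) +
      ∑ j ∈ Finset.range (m / 2 + 1), wL2 ((j : ℝ) + 1 / 2) (iteratedDeriv (m / 2 + j) u) ^ 2
  else
    (∑ i ∈ Finset.range (m / 2 + 1), wL2 0 (iteratedDeriv i u) ^ 2) +
      ∑ j ∈ Finset.range (m / 2 + 1), wL2 ((j : ℝ) + 1) (iteratedDeriv (m / 2 + j + 1) u) ^ 2

/-- The weighted Sobolev norm `Y^m`, valued in `[0,∞]`. -/
def Ynorm {E : Type*} [NormedAddCommGroup E] [NormedSpace ℝ E] (m : ℕ) (u : ℝ → E) : ℝ≥0∞ :=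
  YnormSq m u ^ ((1:ℝ) / 2)

/-- The unified weight `max 0 (n - m/2)`. -/
def wgt (m n : ℕ) : ℝ := max 0 ((n : ℝ) - (m : ℝ) / 2)

/-- The square of the weighted norm as an integral. -/
def wI (α : ℝ) (v : ℝ → ℝ) : ℝ≥0∞ :=
  ∫⁻ s in Set.Ioo (0:ℝ) 1, ENNReal.ofReal (s ^ (2 * α) * ‖v s‖ ^ 2)

lemma wL2_eq (α : ℝ) (v : ℝ → ℝ) : wL2 α v = wI α v ^ ((1:ℝ) / 2) := rfl

lemma half_sq (a : ℝ≥0∞) : (a ^ ((1:ℝ) / 2)) ^ 2 = a := by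
  rw [← ENNReal.rpow_natCast, ← ENNReal.rpow_mul]
  norm_num

lemma sq_half (a : ℝ≥0∞) : (a ^ 2) ^ ((1:ℝ) / 2) = a := by
  rw [← ENNReal.rpow_natCast, ← ENNReal.rpow_mul]
  norm_num

lemma wL2_sq (α : ℝ) (v : ℝ → ℝ) : wL2 α v ^ 2 = wI α v := by
  rw [wL2_eq, half_sq]

lemma XnormSq_eq (m : ℕ) (u : ℝ → ℝ) :
    XnormSq m u = ∑ n ∈ Finset.range (m + 1), wI (wgt m n) (iteratedDeriv n u) := by
  unfold XnormSq
  simp only [wL2_sq]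
  rcases Nat.even_or_odd' m with ⟨k, rfl | rfl⟩
  · have h1 : 2 * k % 2 = 0 := by omega
    have h2 : 2 * k / 2 = k := by omega
    rw [if_pos h1, h2, show 2 * k + 1 = (k + 1) + k by ring, Finset.sum_range_add _ (k + 1) k]
    congr 1
    · refine Finset.sum_congr rfl fun i hi => ?_
      have hi' : (i : ℝ) ≤ k := by exact_mod_cast Nat.lt_succ_iff.mp (Finset.mem_range.mp hi)
      have : wgt (2 * k) i = 0 := by
        unfold wgt; push_cast; exact max_eq_left (by linarith)
      rw [this]
    · refine Finset.sum_congr rfl fun j hj => ?_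
      have : wgt (2 * k) (k + 1 + j) = (j : ℝ) + 1 := by
        unfold wgt; push_cast
        rw [max_eq_right]
        · ring
        · have : (0:ℝ) ≤ j := Nat.cast_nonneg j
          linarith
      rw [this, show k + 1 + j = k + j + 1 by ring]
  · have h1 : ¬ ((2 * k + 1) % 2 = 0) := by omega
    have h2 : (2 * k + 1) / 2 = k := by omega
    rw [if_neg h1, h2, show 2 * k + 1 + 1 = (k + 1) + (k + 1) by ring,
      Finset.sum_range_add _ (k + 1) (k + 1)]
    congr 1
    · refine Finset.sum_congr rfl fun i hi => ?_
      have hi' : (i : ℝ) ≤ k := by exact_mod_cast Nat.lt_succ_iff.mp (Finset.mem_range.mp hi)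
      have : wgt (2 * k + 1) i = 0 := by
        unfold wgt; push_cast; exact max_eq_left (by linarith)
      rw [this]
    · refine Finset.sum_congr rfl fun j hj => ?_
      have : wgt (2 * k + 1) (k + 1 + j) = (j : ℝ) + 1 / 2 := by
        unfold wgt; push_cast
        rw [max_eq_right]
        · ring
        · have : (0:ℝ) ≤ j := Nat.cast_nonneg j
          linarith
      rw [this, show k + 1 + j = k + j + 1 by ring]

lemma smooth_iter {u : ℝ → ℝ} (hu : ContDiffOn ℝ (⊤ : ℕ∞) u (Set.Ioi 0)) (n : ℕ) :
    ContDiffOn ℝ (⊤ : ℕ∞) (iteratedDeriv n u) (Set.Ioi 0) := by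
  induction n with
  | zero => simpa using hu
  | succ n ih =>
    rw [iteratedDeriv_succ]
    exact ih.deriv_of_isOpen isOpen_Ioi (by simp)

lemma diff_iter {u : ℝ → ℝ} (hu : ContDiffOn ℝ (⊤ : ℕ∞) u (Set.Ioi 0)) (n : ℕ) {s : ℝ}
    (hs : 0 < s) : HasDerivAt (iteratedDeriv n u) (iteratedDeriv (n + 1) u s) s := by
  rw [iteratedDeriv_succ]
  exact ((((smooth_iter hu n).contDiffAt (Ioi_mem_nhds hs)).differentiableAt
    (by simp))).hasDerivAt

lemma iter_mul {u : ℝ → ℝ} (hu : ContDiffOn ℝ (⊤ : ℕ∞) u (Set.Ioi 0)) (n : ℕ) :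
    ∀ s : ℝ, 0 < s → iteratedDeriv n (fun s => s * deriv u s) s
      = s * iteratedDeriv (n + 1) u s + n * iteratedDeriv n u s := by
  induction n with
  | zero => intro s hs; simp [iteratedDeriv_one]
  | succ n ih =>
    intro s hs
    rw [iteratedDeriv_succ]
    have he : iteratedDeriv n (fun s => s * deriv u s) =ᶠ[nhds s]
        fun s => s * iteratedDeriv (n + 1) u s + n * iteratedDeriv n u s := by
      filter_upwards [Ioi_mem_nhds hs] with t ht using ih t ht
    rw [he.deriv_eq]
    have := ((hasDerivAt_id s).mul (diff_iter hu (n + 1) hs)).add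
      ((diff_iter hu n hs).const_mul (n : ℝ))
    have h2 := this.deriv
    refine Eq.trans h2 ?_
    simp only [id]
    push_cast
    ring

lemma meas_w {u : ℝ → ℝ} (hu : ContDiffOn ℝ (⊤ : ℕ∞) u (Set.Ioi 0)) (n : ℕ) (α : ℝ) :
    AEMeasurable (fun s => ENNReal.ofReal (s ^ (2 * α) * ‖iteratedDeriv n u s‖ ^ 2))
      (volume.restrict (Set.Ioo (0:ℝ) 1)) := by
  apply ENNReal.measurable_ofReal.comp_aemeasurable
  apply ContinuousOn.aemeasurable _ measurableSet_Ioo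
  have h1 : ContinuousOn (iteratedDeriv n u) (Set.Ioo 0 1) :=
    (smooth_iter hu n).continuousOn.mono (fun x hx => hx.1)
  refine ContinuousOn.mul ?_ (h1.norm.pow 2)
  exact fun x hx => (Real.continuousAt_rpow_const x _ (Or.inl hx.1.ne')).continuousWithinAt

lemma wgt_succ_succ (m n : ℕ) : wgt (m + 1) (n + 1) ≤ wgt m n + 1 := by
  unfold wgt
  push_cast
  apply max_le
  · have := le_max_left 0 ((n : ℝ) - (m : ℝ) / 2); linarith
  · have := le_max_right 0 ((n : ℝ) - (m : ℝ) / 2); linarith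

lemma wgt_succ (m n : ℕ) : wgt (m + 1) n ≤ wgt m n := by
  unfold wgt
  push_cast
  exact max_le_max le_rfl (by linarith)

lemma wI_mul_le {u : ℝ → ℝ} (hu : ContDiffOn ℝ (⊤ : ℕ∞) u (Set.Ioi 0)) (m n : ℕ) (hn : n ≤ m) :
    wI (wgt m n) (iteratedDeriv n (fun s => s * deriv u s)) ≤
      ENNReal.ofReal 2 * wI (wgt (m + 1) (n + 1)) (iteratedDeriv (n + 1) u) +
      ENNReal.ofReal (2 * (m:ℝ) ^ 2) * wI (wgt (m + 1) n) (iteratedDeriv n u) := by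
  unfold wI
  rw [← lintegral_const_mul'' _ (meas_w hu _ _), ← lintegral_const_mul'' _ (meas_w hu _ _),
    ← lintegral_add_left' ((meas_w hu _ _).const_mul _)]
  refine setLIntegral_mono' measurableSet_Ioo fun s hs => ?_
  have hs0 : 0 < s := hs.1
  rw [← ENNReal.ofReal_mul (by norm_num), ← ENNReal.ofReal_mul (by positivity),
    ← ENNReal.ofReal_add (by positivity) (by positivity)]
  apply ENNReal.ofReal_le_ofReal
  rw [iter_mul hu n s hs0]
  simp only [Real.norm_eq_abs, sq_abs]
  set a := iteratedDeriv (n + 1) u s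
  set b := iteratedDeriv n u s
  have hA : s ^ (2 * wgt m n) * s ^ 2 ≤ s ^ (2 * wgt (m + 1) (n + 1)) := by
    have : s ^ (2 * wgt m n) * s ^ 2 = s ^ (2 * wgt m n + 2) := by
      rw [Real.rpow_add hs0]; norm_num
    rw [this]
    exact Real.rpow_le_rpow_of_exponent_ge hs0 hs.2.le (by linarith [wgt_succ_succ m n])
  have hB : s ^ (2 * wgt m n) ≤ s ^ (2 * wgt (m + 1) n) :=
    Real.rpow_le_rpow_of_exponent_ge hs0 hs.2.le (by linarith [wgt_succ m n])
  have hnm : (n:ℝ) ^ 2 ≤ (m:ℝ) ^ 2 := by gcongr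
  have hP : 0 ≤ s ^ (2 * wgt m n) := by positivity
  have hQ : 0 ≤ s ^ (2 * wgt (m + 1) n) := by positivity
  calc s ^ (2 * wgt m n) * (s * a + n * b) ^ 2
      ≤ s ^ (2 * wgt m n) * (2 * (s ^ 2 * a ^ 2) + 2 * ((n:ℝ) ^ 2 * b ^ 2)) := by
        gcongr
        nlinarith [sq_nonneg (s * a - n * b)]
    _ = 2 * ((s ^ (2 * wgt m n) * s ^ 2) * a ^ 2) + 2 * (n:ℝ) ^ 2 * (s ^ (2 * wgt m n) * b ^ 2) := by
        ring
    _ ≤ _ := by gcongr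

lemma part_one {u : ℝ → ℝ} (hu : ContDiffOn ℝ (⊤ : ℕ∞) u (Set.Ioi 0)) (m : ℕ) :
    Xnorm m (fun s => s * deriv u s) ≤ ENNReal.ofReal (2 * (m + 1)) * Xnorm (m + 1) u := by
  have key : XnormSq m (fun s => s * deriv u s) ≤
      ENNReal.ofReal (2 * (m + 1)) ^ 2 * XnormSq (m + 1) u := by
    rw [XnormSq_eq m]
    calc _ ≤ ∑ n ∈ Finset.range (m + 1),
          (ENNReal.ofReal 2 * wI (wgt (m + 1) (n + 1)) (iteratedDeriv (n + 1) u) +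
          ENNReal.ofReal (2 * (m:ℝ) ^ 2) * wI (wgt (m + 1) n) (iteratedDeriv n u)) :=
          Finset.sum_le_sum fun n hn =>
            wI_mul_le hu m n (Nat.lt_succ_iff.mp (Finset.mem_range.mp hn))
      _ = ENNReal.ofReal 2 *
            ∑ n ∈ Finset.range (m + 1), wI (wgt (m + 1) (n + 1)) (iteratedDeriv (n + 1) u) +
          ENNReal.ofReal (2 * (m:ℝ) ^ 2) *
            ∑ n ∈ Finset.range (m + 1), wI (wgt (m + 1) n) (iteratedDeriv n u) := by
          rw [Finset.sum_add_distrib, Finset.mul_sum, Finset.mul_sum]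
      _ ≤ ENNReal.ofReal 2 * XnormSq (m + 1) u +
          ENNReal.ofReal (2 * (m:ℝ) ^ 2) * XnormSq (m + 1) u := by
          rw [XnormSq_eq (m + 1)]
          gcongr
          · rw [Finset.sum_range_succ' _ (m + 1)]
            exact le_self_add
          · omega
      _ = ENNReal.ofReal (2 + 2 * (m:ℝ) ^ 2) * XnormSq (m + 1) u := by
          rw [← add_mul, ENNReal.ofReal_add (by norm_num) (by positivity)]
      _ ≤ _ := by
          rw [← ENNReal.ofReal_pow (by positivity)]
          gcongr
          have : (0:ℝ) ≤ m := Nat.cast_nonneg m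
          nlinarith
  unfold Xnorm
  calc _ ≤ (ENNReal.ofReal (2 * (m + 1)) ^ 2 * XnormSq (m + 1) u) ^ ((1:ℝ) / 2) :=
        ENNReal.rpow_le_rpow key (by norm_num)
    _ = _ := by rw [ENNReal.mul_rpow_of_nonneg _ _ (by norm_num), sq_half]

lemma part_two (u : ℝ → ℝ) (m : ℕ) : Xnorm m (deriv u) ≤ Xnorm (m + 2) u := by
  unfold Xnorm
  refine ENNReal.rpow_le_rpow ?_ (by norm_num)
  rw [XnormSq_eq, XnormSq_eq, Finset.sum_range_succ' _ (m + 2), Finset.sum_range_succ _ (m + 1)]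
  refine le_trans (le_of_eq ?_) (le_trans le_self_add le_self_add)
  refine Finset.sum_congr rfl fun n hn => ?_
  rw [iteratedDeriv_succ']
  congr 1
  unfold wgt
  push_cast
  congr 1
  ring

lemma l1_le {u : ℝ → ℝ} (hu : ContDiffOn ℝ (⊤ : ℕ∞) u (Set.Ioi 0)) (m n : ℕ) (hn : n ≤ m + 1) :
    ∫⁻ t in Set.Ioo (0:ℝ) 1, ‖iteratedDeriv n u t‖ₑ ≤ Xnorm (2 * m + 2) u := by
  have h1 : ContinuousOn (iteratedDeriv n u) (Set.Ioo 0 1) :=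
    (smooth_iter hu n).continuousOn.mono (fun x hx => hx.1)
  have hm : AEMeasurable (fun t => ‖iteratedDeriv n u t‖ₑ) (volume.restrict (Set.Ioo (0:ℝ) 1)) :=
    (h1.aemeasurable measurableSet_Ioo).enorm
  have h2 := ENNReal.lintegral_mul_le_Lp_mul_Lq (volume.restrict (Set.Ioo (0:ℝ) 1))
    Real.HolderConjugate.two_two hm (aemeasurable_const (b := (1:ℝ≥0∞)))
  have h3 : ∫⁻ t in Set.Ioo (0:ℝ) 1, ‖iteratedDeriv n u t‖ₑ ≤
      (∫⁻ t in Set.Ioo (0:ℝ) 1, ‖iteratedDeriv n u t‖ₑ ^ (2:ℝ)) ^ ((1:ℝ) / 2) := by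
    simpa using h2
  refine h3.trans ?_
  unfold Xnorm
  refine ENNReal.rpow_le_rpow ?_ (by norm_num)
  rw [XnormSq_eq]
  have hw : wgt (2 * m + 2) n = 0 := by
    have : (n : ℝ) ≤ m + 1 := by exact_mod_cast hn
    unfold wgt; push_cast; exact max_eq_left (by linarith)
  refine le_trans (le_of_eq ?_) (Finset.single_le_sum
    (f := fun n => wI (wgt (2 * m + 2) n) (iteratedDeriv n u)) (fun _ _ => zero_le)
    (Finset.mem_range.mpr (show n < 2 * m + 2 + 1 by omega)))
  simp only [hw, wI]
  refine lintegral_congr fun t => ?_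
  rw [mul_zero, Real.rpow_zero, one_mul, ENNReal.ofReal_pow (norm_nonneg _), ofReal_norm]
  norm_num

lemma diff_le {u : ℝ → ℝ} (hu : ContDiffOn ℝ (⊤ : ℕ∞) u (Set.Ioi 0)) (m : ℕ) {s t : ℝ}
    (hs : s ∈ Set.Ioo (0:ℝ) 1) (ht : t ∈ Set.Ioo (0:ℝ) 1) (hst : s ≤ t) :
    ‖iteratedDeriv m u t - iteratedDeriv m u s‖ₑ ≤
      ∫⁻ x in Set.Ioo (0:ℝ) 1, ‖iteratedDeriv (m + 1) u x‖ₑ := by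
  have h : ContDiffOn ℝ 1 (iteratedDeriv m u) (Set.Icc s t) :=
    ((smooth_iter hu m).of_le (by simp)).mono
      (fun x hx => lt_of_lt_of_le hs.1 hx.1)
  refine (enorm_sub_le_lintegral_deriv_of_contDiffOn_Icc h hst).trans ?_
  rw [iteratedDeriv_succ]
  exact lintegral_mono_set fun x hx => ⟨lt_of_lt_of_le hs.1 hx.1, lt_of_le_of_lt hx.2 ht.2⟩

lemma part_three {u : ℝ → ℝ} (hu : ContDiffOn ℝ (⊤ : ℕ∞) u (Set.Ioi 0)) (m : ℕ) {s : ℝ}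
    (hs : s ∈ Set.Ioo (0:ℝ) 1) :
    ENNReal.ofReal |iteratedDeriv m u s| ≤ ENNReal.ofReal 2 * Xnorm (2 * m + 2) u := by
  set D := ∫⁻ x in Set.Ioo (0:ℝ) 1, ‖iteratedDeriv (m + 1) u x‖ₑ with hD
  have hpt : ∀ t ∈ Set.Ioo (0:ℝ) 1,
      ‖iteratedDeriv m u s‖ₑ ≤ ‖iteratedDeriv m u t‖ₑ + D := by
    intro t ht
    have hd : ‖iteratedDeriv m u s - iteratedDeriv m u t‖ₑ ≤ D := by
      rcases le_total s t with h | h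
      · rw [← enorm_neg, neg_sub]; exact diff_le hu m hs ht h
      · exact diff_le hu m ht hs h
    calc ‖iteratedDeriv m u s‖ₑ
        = ‖iteratedDeriv m u t + (iteratedDeriv m u s - iteratedDeriv m u t)‖ₑ := by
          congr 1; ring
      _ ≤ _ := (enorm_add_le _ _).trans (by gcongr)
  have h1 : ∫⁻ _ in Set.Ioo (0:ℝ) 1, ‖iteratedDeriv m u s‖ₑ ≤
      ∫⁻ t in Set.Ioo (0:ℝ) 1, (‖iteratedDeriv m u t‖ₑ + D) :=
    setLIntegral_mono' measurableSet_Ioo hpt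
  rw [lintegral_add_right _ measurable_const] at h1
  simp only [setLIntegral_const, Real.volume_Ioo, sub_zero, ENNReal.ofReal_one, mul_one] at h1
  rw [← Real.norm_eq_abs, ofReal_norm]
  refine h1.trans ?_
  have e : ENNReal.ofReal 2 = 1 + 1 := by norm_num
  rw [e, add_mul, one_mul]
  exact add_le_add (l1_le hu m m (by omega)) (l1_le hu m (m + 1) le_rfl)

/-- `‖s u'‖_{X^m} ≤ C ‖u‖_{X^{m+1}}`, `‖u'‖_{X^m} ≤ ‖u‖_{X^{m+2}}`, and
`sup_{0<s<1} |∂^m u| ≤ C ‖u‖_{X^{2m+2}}`. -/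
theorem stmt19 (m : ℕ) :
    ∃ C : ℝ, 0 < C ∧ ∀ u : ℝ → ℝ,
      ContDiffOn ℝ (⊤ : ℕ∞) u (Set.Ioi 0) →
      Xnorm (m + 1) u ≠ ⊤ → Xnorm (m + 2) u ≠ ⊤ → Xnorm (2 * m + 2) u ≠ ⊤ →
      (Xnorm m (fun s => s * deriv u s) ≤ ENNReal.ofReal C * Xnorm (m + 1) u) ∧
      (Xnorm m (deriv u) ≤ Xnorm (m + 2) u) ∧
      (∀ s ∈ Set.Ioo (0:ℝ) 1,
        ENNReal.ofReal |iteratedDeriv m u s| ≤ ENNReal.ofReal C * Xnorm (2 * m + 2) u) := by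
  refine ⟨2 * (m + 1), by positivity, fun u hu _ _ _ => ⟨part_one hu m, part_two u m,
    fun s hs => (part_three hu m hs).trans ?_⟩⟩
  gcongr
  have : (0:ℝ) ≤ m := Nat.cast_nonneg m
  linarith
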